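/- Let ε > 0, x* ∈ ℝ^d, let Q, R be symmetric positive definite d×d real matrices, and define the LQR transition cost ℓ(x, y) := ½ (x − x*)ᵀ Q (x − x*) + ½ (y − x)ᵀ R (y − x). Let α ∈ ℝ^d and let P be a symmetric positive definite d×d matrix. Set Σ⁺ := ε R⁻¹ + (Q/ε + P)⁻¹ and α⁺ := (Q/ε + P)⁻¹ ( (Q/ε) x* + P α ). Then Σ⁺ is symmetric positive definite and there exists a constant c > 0, independent of y, such that for all y ∈ ℝ^d, ∫_{ℝ^d} exp(−ℓ(x, y)/ε) · N(x | α, P⁻¹) dx = c · N(y | α⁺, Σ⁺). -/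

import Mathlib

open MeasureTheory Matrix

/-- The Gaussian density `N(x|μ,Σ) = (2π)^{-d/2} (det Σ)^{-1/2} exp(-½ (x-μ)ᵀ Σ⁻¹ (x-μ))`
on `ℝ^d`. -/
noncomputable def gaussPDF (d : ℕ) (m : Fin d → ℝ) (S : Matrix (Fin d) (Fin d) ℝ)
    (x : Fin d → ℝ) : ℝ :=
  (2 * Real.pi) ^ (-(d : ℝ) / 2) * S.det ^ (-(1 : ℝ) / 2) *
    Real.exp (-(1 / 2) * ((x - m) ⬝ᵥ (S⁻¹ *ᵥ (x - m))))

/-- The LQR transition cost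
`ℓ(x, y) := ½ (x − x*)ᵀ Q (x − x*) + ½ (y − x)ᵀ R (y − x)`. -/
noncomputable def lqrCost {d : ℕ} (xs : Fin d → ℝ) (Q R : Matrix (Fin d) (Fin d) ℝ)
    (x y : Fin d → ℝ) : ℝ :=
  (1 / 2) * ((x - xs) ⬝ᵥ (Q *ᵥ (x - xs))) + (1 / 2) * ((y - x) ⬝ᵥ (R *ᵥ (y - x)))

theorem Matrix.PosDef.dotProduct_mulVec_comm {n : Type*} [Fintype n] {A : Matrix n n ℝ}
    (hA : A.PosDef) (x y : n → ℝ) : x ⬝ᵥ (A *ᵥ y) = y ⬝ᵥ (A *ᵥ x) := by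
  have hT : Aᵀ = A := by simpa [conjTranspose_eq_transpose_of_trivial] using hA.isHermitian.eq
  rw [dotProduct_mulVec, ← mulVec_transpose, hT, dotProduct_comm]

/-- The sum of two positive definite quadratic forms centred at `a` and `b`, after completing
the square. -/
theorem Matrix.PosDef.dotProduct_mulVec_sub_add_sub {n : Type*} [Fintype n] [DecidableEq n]
    {A B : Matrix n n ℝ} (hA : A.PosDef) (hB : B.PosDef) (x a b : n → ℝ) :
    (x - a) ⬝ᵥ (A *ᵥ (x - a)) + (x - b) ⬝ᵥ (B *ᵥ (x - b)) =
      (x - (A + B)⁻¹ *ᵥ (A *ᵥ a + B *ᵥ b)) ⬝ᵥ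
          ((A + B) *ᵥ (x - (A + B)⁻¹ *ᵥ (A *ᵥ a + B *ᵥ b))) +
        (a - b) ⬝ᵥ ((A⁻¹ + B⁻¹)⁻¹ *ᵥ (a - b)) := by
  have key : (A + B) *ᵥ ((A + B)⁻¹ *ᵥ (A *ᵥ a + B *ᵥ b)) = A *ᵥ a + B *ᵥ b := by
    rw [mulVec_mulVec, mul_nonsing_inv _ ((isUnit_iff_isUnit_det _).1 (hA.add hB).isUnit),
      one_mulVec]
  set c := (A + B)⁻¹ *ᵥ (A *ᵥ a + B *ᵥ b)
  have hw : A *ᵥ (a - c) = B *ᵥ (c - b) := by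
    rw [add_mulVec] at key
    simp only [mulVec_sub]
    rw [sub_eq_sub_iff_add_eq_add, ← key, add_comm]
  have hinv : (A⁻¹ + B⁻¹)⁻¹ *ᵥ (a - b) = A *ᵥ (a - c) := by
    have : a - b = (A⁻¹ + B⁻¹) *ᵥ (A *ᵥ (a - c)) := by
      rw [add_mulVec]
      nth_rewrite 2 [hw]
      rw [mulVec_mulVec, mulVec_mulVec,
        nonsing_inv_mul _ ((isUnit_iff_isUnit_det _).1 hA.isUnit),
        nonsing_inv_mul _ ((isUnit_iff_isUnit_det _).1 hB.isUnit), one_mulVec, one_mulVec,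
        sub_add_sub_cancel]
    rw [this, mulVec_mulVec,
      nonsing_inv_mul _ ((isUnit_iff_isUnit_det _).1 (hA.inv.add hB.inv).isUnit), one_mulVec]
  rw [hinv]
  have hxa : x - a = (x - c) - (a - c) := by abel
  have hxb : x - b = (x - c) + (c - b) := by abel
  have hab : a - b = (a - c) + (c - b) := by abel
  rw [hxa, hxb, hab]
  generalize x - c = u at hw ⊢
  generalize a - c = p at hw ⊢
  generalize c - b = q at hw ⊢
  have hpA := hA.dotProduct_mulVec_comm p u
  have hqB := hB.dotProduct_mulVec_comm q u
  have hu : u ⬝ᵥ (A *ᵥ p) = u ⬝ᵥ (B *ᵥ q) := by rw [hw]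
  have hq : q ⬝ᵥ (A *ᵥ p) = q ⬝ᵥ (B *ᵥ q) := by rw [hw]
  simp only [mulVec_sub, mulVec_add, add_mulVec, sub_dotProduct, dotProduct_sub, add_dotProduct,
    dotProduct_add]
  linarith

open scoped MatrixOrder in
theorem Matrix.PosDef.integrable_exp_neg_half {n : Type*} [Fintype n] [DecidableEq n]
    {A : Matrix n n ℝ} (hA : A.PosDef) :
    Integrable fun x : n → ℝ => Real.exp (-(1 / 2) * (x ⬝ᵥ (A *ᵥ x))) := by
  obtain ⟨B, hB, rfl⟩ : ∃ B : Matrix n n ℝ, IsUnit B ∧ A = Bᴴ * B :=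
    CStarAlgebra.isStrictlyPositive_iff_eq_star_mul_self.1 hA.isStrictlyPositive
  have hdet : B.det ≠ 0 := ((isUnit_iff_isUnit_det _).1 hB).ne_zero
  have hstd : Integrable fun x : n → ℝ => Real.exp (-(1 / 2) * (x ⬝ᵥ x)) := by
    simp_rw [dotProduct, Finset.mul_sum, Real.exp_sum]
    refine Integrable.fintype_prod (f := fun _ (v : ℝ) => Real.exp (-(1 / 2) * (v * v)))
      fun _ => ?_
    simpa only [sq] using integrable_exp_neg_mul_sq (b := 1 / 2) (by norm_num)
  have hmap : Integrable (fun x : n → ℝ => Real.exp (-(1 / 2) * (x ⬝ᵥ x)))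
      (Measure.map (toLin' B) volume) := by
    rw [Real.map_matrix_volume_pi_eq_smul_volume_pi hdet]
    exact hstd.smul_measure ENNReal.ofReal_ne_top
  refine (hmap.comp_measurable (toLin' B).continuous_of_finiteDimensional.measurable).congr
    (.of_forall fun x => ?_)
  simp [toLin'_apply, ← mulVec_mulVec, dotProduct_mulVec,
    conjTranspose_eq_transpose_of_trivial, vecMul_transpose]

theorem gaussPDF_normalization_pos {d : ℕ} {S : Matrix (Fin d) (Fin d) ℝ} (hS : S.PosDef) :
    0 < (2 * Real.pi) ^ (-(d : ℝ) / 2) * S.det ^ (-(1 : ℝ) / 2) :=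
  mul_pos (Real.rpow_pos_of_pos (by positivity) _) (Real.rpow_pos_of_pos hS.det_pos _)

/-- **Forward propagation of a Gaussian potential through the LQR kernel.** For `ε > 0`,
`x* ∈ ℝ^d`, symmetric positive definite `Q, R`, a mean `α` and a symmetric positive
definite precision `P`, set `Σ⁺ := ε R⁻¹ + (Q/ε + P)⁻¹` and
`α⁺ := (Q/ε + P)⁻¹((Q/ε) x* + P α)`. Then `Σ⁺` is symmetric positive definite and there
is a constant `c > 0`, independent of `y`, with
`∫ exp(−ℓ(x,y)/ε) N(x|α, P⁻¹) dx = c · N(y|α⁺, Σ⁺)` for all `y`. -/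
theorem forward_gaussian_potential_propagation
    {d : ℕ} (ε : ℝ) (hε : 0 < ε) (xs α : Fin d → ℝ)
    (Q R P : Matrix (Fin d) (Fin d) ℝ)
    (hQ : Q.PosDef) (hR : R.PosDef) (hP : P.PosDef) :
    (ε • R⁻¹ + (ε⁻¹ • Q + P)⁻¹).PosDef ∧
      ∃ c : ℝ, 0 < c ∧
        ∀ y : Fin d → ℝ,
          (∫ x : Fin d → ℝ,
              Real.exp (-(lqrCost xs Q R x y) / ε) * gaussPDF d α P⁻¹ x) =
            c * gaussPDF d
              ((ε⁻¹ • Q + P)⁻¹ *ᵥ ((ε⁻¹ • Q) *ᵥ xs + P *ᵥ α))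
              (ε • R⁻¹ + (ε⁻¹ • Q + P)⁻¹) y := by
  have hM : (ε⁻¹ • Q + P).PosDef := (hQ.smul (inv_pos.2 hε)).add hP
  have hS : (ε • R⁻¹ + (ε⁻¹ • Q + P)⁻¹).PosDef := (hR.inv.smul hε).add hM.inv
  refine ⟨hS, ?_⟩
  have hA : (ε⁻¹ • R).PosDef := hR.smul (inv_pos.2 hε)
  have hAinv : (ε⁻¹ • R)⁻¹ = ε • R⁻¹ := by
    refine inv_eq_right_inv ?_
    rw [smul_mul_smul_comm, inv_mul_cancel₀ hε.ne', one_smul,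
      mul_nonsing_inv _ ((isUnit_iff_isUnit_det _).1 hR.isUnit)]
  have hPinv : P⁻¹⁻¹ = P := nonsing_inv_nonsing_inv _ ((isUnit_iff_isUnit_det _).1 hP.isUnit)
  set M := ε⁻¹ • Q + P
  set m := M⁻¹ *ᵥ ((ε⁻¹ • Q) *ᵥ xs + P *ᵥ α)
  set S := ε • R⁻¹ + M⁻¹
  set K := (xs - α) ⬝ᵥ (((ε⁻¹ • Q)⁻¹ + P⁻¹)⁻¹ *ᵥ (xs - α))
  set N := ε⁻¹ • R + M
  set Z := (2 * Real.pi) ^ (-(d : ℝ) / 2) * P⁻¹.det ^ (-(1 : ℝ) / 2) with hZ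
  set W := (2 * Real.pi) ^ (-(d : ℝ) / 2) * S.det ^ (-(1 : ℝ) / 2) with hW
  have hZpos : 0 < Z := gaussPDF_normalization_pos hP.inv
  have hWpos : 0 < W := gaussPDF_normalization_pos hS
  have hI := integral_exp_pos (hA.add hM).integrable_exp_neg_half
  set I := ∫ x : Fin d → ℝ, Real.exp (-(1 / 2) * (x ⬝ᵥ (N *ᵥ x))) with hIdef
  refine ⟨Z * Real.exp (-(1 / 2) * K) * I / W, by positivity, fun y => ?_⟩
  have hpoint : ∀ x : Fin d → ℝ,
      Real.exp (-(lqrCost xs Q R x y) / ε) * gaussPDF d α P⁻¹ x =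
        Z * Real.exp (-(1 / 2) * K) * Real.exp (-(1 / 2) * ((y - m) ⬝ᵥ (S⁻¹ *ᵥ (y - m)))) *
          Real.exp (-(1 / 2) * ((x - N⁻¹ *ᵥ ((ε⁻¹ • R) *ᵥ y + M *ᵥ m)) ⬝ᵥ
            (N *ᵥ (x - N⁻¹ *ᵥ ((ε⁻¹ • R) *ᵥ y + M *ᵥ m))))) := fun x => by
    have h₁ := (hQ.smul (inv_pos.2 hε)).dotProduct_mulVec_sub_add_sub hP x xs α
    have h₂ := hA.dotProduct_mulVec_sub_add_sub hM x y m
    rw [hAinv] at h₂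
    have hneg : (y - x) ⬝ᵥ (R *ᵥ (y - x)) = (x - y) ⬝ᵥ (R *ᵥ (x - y)) := by
      rw [← neg_sub x y, mulVec_neg, neg_dotProduct_neg]
    have hcost : -(lqrCost xs Q R x y) / ε =
        -(1 / 2) * ((x - xs) ⬝ᵥ ((ε⁻¹ • Q) *ᵥ (x - xs))) +
          -(1 / 2) * ((x - y) ⬝ᵥ ((ε⁻¹ • R) *ᵥ (x - y))) := by
      simp only [lqrCost, hneg, smul_mulVec, dotProduct_smul, smul_eq_mul]
      ring
    rw [gaussPDF, hPinv, ← hZ, hcost, mul_left_comm, ← Real.exp_add]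
    simp only [mul_assoc, ← Real.exp_add]
    congr 2
    linarith
  simp_rw [hpoint]
  rw [integral_const_mul, integral_sub_right_eq_self
    (fun x : Fin d → ℝ => Real.exp (-(1 / 2) * (x ⬝ᵥ (N *ᵥ x)))), gaussPDF, ← hW, ← hIdef]
  field_simp
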